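/- Let N ≥ 1 and define V : ℝ^N → ℝ by V(x) := ∏_{1≤i<j≤N} sin((x_i − x_j)/2). Then V is an eigenfunction of the Laplacian: for every x ∈ ℝ^N, ∑_{i=1}^N (∂²V/∂x_i²)(x) = −((N−1)·N·(N+1)/12) · V(x). -/

import Mathlib

/-- `V(x) = ∏_{1 ≤ i < j ≤ N} sin((x_i - x_j)/2)`. -/
noncomputable def Vsin (N : ℕ) (x : Fin N → ℝ) : ℝ :=
  ∏ i : Fin N, ∏ j ∈ Finset.Ioi i, Real.sin ((x i - x j) / 2)

open Complex in
/-- The frequency `I (k - (N - 1) / 2)` of the `k`-th exponential in the expansion of `Vsin`. -/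
noncomputable def vsinFreq (N : ℕ) (k : Fin N) : ℂ :=
  I * ((k : ℂ) - ((N : ℂ) - 1) / 2)

theorem sum_range_natCast_sub_sq (n : ℕ) (a : ℂ) :
    ∑ k ∈ Finset.range n, ((k : ℂ) - a) ^ 2
      = ((n : ℂ) - 1) * n * (2 * n - 1) / 6 - a * n * (n - 1) + n * a ^ 2 := by
  induction n with
  | zero => simp
  | succ n ih =>
    rw [Finset.sum_range_succ, ih]
    push_cast
    ring

theorem sum_vsinFreq_sq (N : ℕ) :
    ∑ k, vsinFreq N k ^ 2 = -(((N : ℂ) - 1) * N * (N + 1) / 12) := by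
  simp only [vsinFreq, mul_pow, Complex.I_sq, ← Finset.mul_sum]
  rw [Fin.sum_univ_eq_sum_range (fun k : ℕ => ((k : ℂ) - ((N : ℂ) - 1) / 2) ^ 2) N,
    sum_range_natCast_sub_sq]
  ring

theorem Fin.prod_prod_Ioi_mul {M : Type*} [CommMonoid M] (N : ℕ) (f : Fin N → M) :
    ∏ i, ∏ j ∈ Finset.Ioi i, f i * f j = ∏ i, f i ^ (N - 1) := by
  have h : ∏ i, ∏ j ∈ Finset.Ioi i, f j = ∏ j, ∏ _i ∈ Finset.Iio j, f j :=
    Finset.prod_comm' (by simp)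
  simp only [Finset.prod_mul_distrib]
  rw [h, ← Finset.prod_mul_distrib]
  refine Finset.prod_congr rfl fun i _ => ?_
  rw [Finset.prod_const, Finset.prod_const, ← pow_add, Fin.card_Ioi, Fin.card_Iio]
  congr 1
  have := i.isLt
  omega

open Complex in
theorem Complex.sin_sub_div_two (a b : ℂ) :
    sin ((a - b) / 2)
      = I / 2 * (exp (-(I * a / 2)) * exp (-(I * b / 2))) * (exp (I * b) - exp (I * a)) := by
  have h₁ : exp (-((a - b) / 2) * I)
      = exp (-(I * a / 2)) * exp (-(I * b / 2)) * exp (I * b) := by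
    rw [← exp_add, ← exp_add]
    ring_nf
  have h₂ : exp ((a - b) / 2 * I)
      = exp (-(I * a / 2)) * exp (-(I * b / 2)) * exp (I * a) := by
    rw [← exp_add, ← exp_add]
    ring_nf
  rw [sin, h₁, h₂]
  ring

open Complex in
/-- The Weyl denominator expansion of `Vsin`, from the Vandermonde determinant. -/
theorem exists_Vsin_eq_sum_perm (N : ℕ) : ∃ c : ℂ, ∀ x : Fin N → ℝ,
    (Vsin N x : ℂ) = ∑ σ : Equiv.Perm (Fin N),
      c * (Equiv.Perm.sign σ : ℤ) * ∏ k, exp (vsinFreq N (σ k) * x k) := by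
  refine ⟨∏ i : Fin N, ∏ _j ∈ Finset.Ioi i, I / 2, fun x => ?_⟩
  simp only [Vsin, ofReal_prod, ofReal_sin, ofReal_div, ofReal_sub, ofReal_ofNat,
    sin_sub_div_two]
  have hv := Matrix.det_vandermonde fun i => exp (I * x i)
  have hp := Fin.prod_prod_Ioi_mul N fun i => exp (-(I * x i / 2))
  simp only [Finset.prod_mul_distrib] at hp ⊢
  rw [hp, ← hv, ← Matrix.det_transpose, Matrix.det_apply', Finset.mul_sum]
  refine Finset.sum_congr rfl fun σ _ => ?_
  have h : ∏ k, exp (vsinFreq N (σ k) * x k)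
      = (∏ k, exp (-(I * x k / 2)) ^ (N - 1)) * ∏ k, exp (I * x k) ^ (σ k : ℕ) := by
    rw [← Finset.prod_mul_distrib]
    refine Finset.prod_congr rfl fun k _ => ?_
    have hN : 1 ≤ N := by have := k.isLt; omega
    rw [← exp_nat_mul, ← exp_nat_mul, ← exp_add, vsinFreq, Nat.cast_sub hN]
    push_cast
    ring_nf
  rw [h]
  simp only [Matrix.transpose_apply, Matrix.vandermonde_apply]
  ring

/-- The second derivative of the real part of an exponential sum. -/
theorem deriv_deriv_re_sum_exp {ι : Type*} (s : Finset ι) (A m : ι → ℂ) (t : ℝ) :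
    deriv (deriv fun t : ℝ => (∑ σ ∈ s, A σ * Complex.exp (m σ * t)).re) t
      = (∑ σ ∈ s, A σ * m σ ^ 2 * Complex.exp (m σ * t)).re := by
  have key : ∀ (B : ι → ℂ) (t : ℝ),
      HasDerivAt (fun t : ℝ => (∑ σ ∈ s, B σ * Complex.exp (m σ * t)).re)
        (∑ σ ∈ s, B σ * m σ * Complex.exp (m σ * t)).re t := by
    intro B t
    refine HasDerivAt.real_of_complex
      (e := fun z : ℂ => ∑ σ ∈ s, B σ * Complex.exp (m σ * z)) ?_
    refine HasDerivAt.fun_sum fun σ _ => ?_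
    have h := ((hasDerivAt_mul_const (x := (t : ℂ)) (m σ)).cexp.const_mul (B σ))
    simpa only [mul_comm, mul_assoc, mul_left_comm] using h
  rw [funext fun t => (key A t).deriv, (key (fun σ => A σ * m σ) t).deriv]
  simp only [pow_two, mul_assoc]

/-- `V` is an eigenfunction of the Laplacian on `ℝ^N`:
`∑_i ∂²V/∂x_i² = -((N-1)N(N+1)/12) V`.  The second partial derivative in the `i`-th
coordinate is expressed as the second derivative of `t ↦ V(update x i t)` at `x i`. -/
theorem Vsin_laplacian_eigenfunction (N : ℕ) (hN : 1 ≤ N) (x : Fin N → ℝ) :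
    ∑ i : Fin N,
        deriv (deriv (fun t : ℝ => Vsin N (Function.update x i t))) (x i)
      = -(((N : ℝ) - 1) * (N : ℝ) * ((N : ℝ) + 1) / 12) * Vsin N x := by
  obtain ⟨c, hc⟩ := exists_Vsin_eq_sum_perm N
  set T : Equiv.Perm (Fin N) → ℂ := fun σ =>
    c * (Equiv.Perm.sign σ : ℤ) * ∏ k, Complex.exp (vsinFreq N (σ k) * x k) with hT
  have hd : ∀ i, deriv (deriv fun t : ℝ => Vsin N (Function.update x i t)) (x i)
      = (∑ σ, vsinFreq N (σ i) ^ 2 * T σ).re := by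
    intro i
    have hF : (fun t : ℝ => Vsin N (Function.update x i t)) = fun t : ℝ =>
        (∑ σ : Equiv.Perm (Fin N), (c * (Equiv.Perm.sign σ : ℤ) *
          ∏ k ∈ Finset.univ.erase i, Complex.exp (vsinFreq N (σ k) * x k)) *
            Complex.exp (vsinFreq N (σ i) * t)).re := by
      funext t
      rw [← Complex.ofReal_re (Vsin N _), hc]
      congr 1
      refine Finset.sum_congr rfl fun σ _ => ?_
      rw [← Finset.prod_erase_mul _ _ (Finset.mem_univ i), Function.update_self, ← mul_assoc]
      congr 2
      refine Finset.prod_congr rfl fun k hk => ?_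
      rw [Function.update_of_ne (Finset.ne_of_mem_erase hk)]
    rw [hF, deriv_deriv_re_sum_exp]
    congr 1
    refine Finset.sum_congr rfl fun σ _ => ?_
    rw [hT]
    beta_reduce
    rw [← Finset.prod_erase_mul _ _ (Finset.mem_univ i)]
    ring
  have hs : ∑ i, ∑ σ, vsinFreq N (σ i) ^ 2 * T σ
      = ((-(((N : ℝ) - 1) * N * (N + 1) / 12) * Vsin N x : ℝ) : ℂ) := by
    rw [Finset.sum_comm]
    push_cast
    rw [hc x, Finset.mul_sum]
    refine Finset.sum_congr rfl fun σ _ => ?_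
    rw [← Finset.sum_mul, Equiv.sum_comp σ fun k => vsinFreq N k ^ 2, sum_vsinFreq_sq]
  simp only [hd]
  rw [← Complex.re_sum, hs, Complex.ofReal_re]
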